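/- Let (R, m) be a commutative Noetherian local ring. Suppose that for any parameter ideals a and b of R with b ⊆ a, the R-module Hom_R(R/a, R/b) is cyclic. Then R is a Cohen-Macaulay ring. -/

import Mathlib

open IsLocalRing

/-- A parameter ideal of a Noetherian local ring: an ideal generated by a system of
parameters, i.e. by `d` elements of the maximal ideal (where `d` is the Krull dimension
of the ring) generating an ideal whose radical is the maximal ideal. -/
def IsParameterIdeal (R : Type*) [CommRing R] [IsLocalRing R] (I : Ideal R) : Prop :=
  ∃ (d : ℕ) (a : Fin d → R), ringKrullDim R = d ∧ (∀ i, a i ∈ maximalIdeal R) ∧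
    I = Ideal.span (Set.range a) ∧ I.radical = maximalIdeal R

/-- The depth of a Noetherian local ring `R`: the supremum of the lengths of
regular sequences consisting of elements of the maximal ideal. -/
noncomputable def ringDepth (R : Type*) [CommRing R] [IsLocalRing R] : ℕ∞ :=
  sSup {n : ℕ∞ | ∃ (k : ℕ) (a : Fin k → R), (k : ℕ∞) = n ∧
    (∀ i, a i ∈ maximalIdeal R) ∧ RingTheory.Sequence.IsRegular R (List.ofFn a)}

/-- A Noetherian local ring is Cohen–Macaulay if its depth equals its Krull dimension. -/
def IsCohenMacaulayLocalRing (R : Type*) [CommRing R] [IsLocalRing R] : Prop :=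
  (ringDepth R : WithBot ℕ∞) = ringKrullDim R

/-- If `Hom(R/a, R/b)` is cyclic then so is `(b : a)` modulo `b`. -/
lemma Ideal.exists_generator_colon_of_isPrincipal_hom {R : Type*} [CommRing R] {a b : Ideal R}
    (h : Submodule.IsPrincipal (⊤ : Submodule R ((R ⧸ a) →ₗ[R] (R ⧸ b)))) :
    ∃ c : R, (∀ r ∈ a, r * c ∈ b) ∧ ∀ y : R, (∀ r ∈ a, r * y ∈ b) → ∃ t : R, y - t * c ∈ b := by
  obtain ⟨⟨f, hf⟩⟩ := h
  obtain ⟨c, hc⟩ := Ideal.Quotient.mk_surjective (f (Ideal.Quotient.mk a 1))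
  have key : ∀ r, f (Ideal.Quotient.mk a r) = Ideal.Quotient.mk b (r * c) := by
    intro r
    have : (Ideal.Quotient.mk a r) = r • (Ideal.Quotient.mk a 1) := by
      simp [Algebra.smul_def]
    rw [this, map_smul, ← hc, map_mul, Algebra.smul_def]
    rfl
  refine ⟨c, fun r hr => ?_, fun y hy => ?_⟩
  · rw [← Ideal.Quotient.eq_zero_iff_mem, ← key, Ideal.Quotient.eq_zero_iff_mem.mpr hr, map_zero]
  · let g : (R ⧸ a) →ₗ[R] (R ⧸ b) :=
      Submodule.liftQ a (LinearMap.toSpanSingleton R (R ⧸ b) (Ideal.Quotient.mk b y)) (by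
        intro r hr
        have := Ideal.Quotient.eq_zero_iff_mem.mpr (hy r hr)
        rw [map_mul] at this
        simpa [Algebra.smul_def] using this)
    have hg : g (Ideal.Quotient.mk a 1) = Ideal.Quotient.mk b y := by
      change (1 : R) • (Ideal.Quotient.mk b y) = _
      simp
    have hmem : g ∈ (⊤ : Submodule R ((R ⧸ a) →ₗ[R] (R ⧸ b))) := trivial
    rw [hf, Submodule.mem_span_singleton] at hmem
    obtain ⟨t, ht⟩ := hmem
    refine ⟨t, ?_⟩
    rw [← Ideal.Quotient.eq, ← hg, ← ht, LinearMap.smul_apply, ← hc, map_mul, Algebra.smul_def]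
    rfl

/-- If `(I + (x ^ (n + 1)) : x)` is generated by one element modulo `I + (x ^ (n + 1))` and no
power of `x` lies in `I`, then `(I : x) ⊆ I + (x ^ n)`. -/
lemma IsLocalRing.mem_sup_span_pow_of_colon_cyclic {R : Type*} [CommRing R] [IsLocalRing R]
    {I : Ideal R} {x c z : R} {n : ℕ} (hx : x ∈ maximalIdeal R) (hI : x ^ (n + 1) ∉ I)
    (hc : x * c ∈ I ⊔ Ideal.span {x ^ (n + 1)})
    (hgen : ∀ y, x * y ∈ I ⊔ Ideal.span {x ^ (n + 1)} →
      ∃ t, y - t * c ∈ I ⊔ Ideal.span {x ^ (n + 1)})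
    (hz : x * z ∈ I) : z ∈ I ⊔ Ideal.span {x ^ n} := by
  have hle : I ⊔ Ideal.span {x ^ (n + 1)} ≤ I ⊔ Ideal.span {x ^ n} :=
    sup_le_sup_left (Ideal.span_singleton_le_span_singleton.mpr (pow_dvd_pow x n.le_succ)) I
  have hxn : x ^ n ∈ I ⊔ Ideal.span {x ^ n} :=
    Ideal.mem_sup_right (Ideal.mem_span_singleton_self _)
  obtain ⟨t, ht⟩ := hgen (x ^ n) (by
    rw [← pow_succ']
    exact Ideal.mem_sup_right (Ideal.mem_span_singleton_self _))
  by_cases hu : IsUnit t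
  · obtain ⟨s, hs⟩ := hgen z (Ideal.mem_sup_left hz)
    have htc : t * c ∈ I ⊔ Ideal.span {x ^ n} := by
      simpa using sub_mem hxn (hle ht)
    have hcc : c ∈ I ⊔ Ideal.span {x ^ n} := (Ideal.unit_mul_mem_iff_mem _ hu).mp htc
    simpa using add_mem (hle hs) (Ideal.mul_mem_left _ s hcc)
  · exfalso
    rw [Submodule.mem_sup] at hc ht
    obtain ⟨i, hi, j, hj, hij⟩ := hc
    obtain ⟨i', hi', j', hj', hij'⟩ := ht
    obtain ⟨r, rfl⟩ := Ideal.mem_span_singleton'.mp hj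
    obtain ⟨r', rfl⟩ := Ideal.mem_span_singleton'.mp hj'
    have hm : t * r + r' * x ∈ maximalIdeal R :=
      add_mem (Ideal.mul_mem_right _ _ hu) (Ideal.mul_mem_left _ _ hx)
    have hunit : IsUnit (1 - (t * r + r' * x)) := by
      by_contra hnu
      exact (Ideal.ne_top_iff_one _).mp (maximalIdeal.isMaximal R).ne_top
        (by simpa using add_mem (show 1 - (t * r + r' * x) ∈ maximalIdeal R from hnu) hm)
    refine hI ((Ideal.unit_mul_mem_iff_mem _ hunit).mp ?_)
    have : (1 - (t * r + r' * x)) * x ^ (n + 1) = t * i + x * i' := by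
      linear_combination -t * hij - x * hij'
    rw [this]
    exact add_mem (Ideal.mul_mem_left _ _ hi) (Ideal.mul_mem_left _ _ hi')

lemma IsLocalRing.mem_of_forall_mem_sup_pow {R : Type*} [CommRing R] [IsNoetherianRing R]
    [IsLocalRing R] {I : Ideal R} {z : R} (h : ∀ n, z ∈ I ⊔ maximalIdeal R ^ n) : z ∈ I := by
  rw [← Ideal.Quotient.eq_zero_iff_mem]
  refine IsHausdorff.haus (inferInstance : IsHausdorff (maximalIdeal R) (R ⧸ I)) _ fun n => ?_
  obtain ⟨i, hi, j, hj, rfl⟩ := Submodule.mem_sup.mp (h n)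
  rw [SModEq.zero, map_add, Ideal.Quotient.eq_zero_iff_mem.mpr hi, zero_add]
  have : Ideal.Quotient.mk I j = j • (1 : R ⧸ I) := by simp [Algebra.smul_def]
  rw [this]
  exact Submodule.smul_mem_smul hj trivial

section SystemOfParameters

variable {R : Type*} [CommRing R] [IsLocalRing R] {d : ℕ} {a : Fin d → R}

lemma isParameterIdeal_span_pow (hd : ringKrullDim R = d) (ha : ∀ i, a i ∈ maximalIdeal R)
    (hr : (Ideal.span (Set.range a)).radical = maximalIdeal R) {e : Fin d → ℕ}
    (he : ∀ i, e i ≠ 0) : IsParameterIdeal R (Ideal.span (Set.range fun i => a i ^ e i)) := by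
  have hmem : ∀ i, a i ^ e i ∈ maximalIdeal R :=
    fun i => Ideal.pow_mem_of_mem _ (ha i) _ (he i).bot_lt
  refine ⟨d, fun i => a i ^ e i, hd, hmem, rfl, le_antisymm ?_ ?_⟩
  · refine (maximalIdeal.isMaximal R).isPrime.radical_le_iff.mpr (Ideal.span_le.mpr ?_)
    rintro _ ⟨i, rfl⟩
    exact hmem i
  · rw [← hr, Ideal.radical_le_radical_iff, Ideal.span_le]
    rintro _ ⟨i, rfl⟩
    exact ⟨e i, Ideal.subset_span ⟨i, rfl⟩⟩

lemma pow_notMem_span_image_compl [IsNoetherianRing R] (hd : ringKrullDim R = d)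
    (hr : (Ideal.span (Set.range a)).radical = maximalIdeal R) (i : Fin d) (n : ℕ) :
    a i ^ n ∉ Ideal.span (a '' {i}ᶜ) := by
  intro hn
  have hrad : (Ideal.span (a '' {i}ᶜ)).radical = maximalIdeal R := by
    refine le_antisymm (hr ▸ Ideal.radical_mono (Ideal.span_mono (Set.image_subset_range _ _))) ?_
    rw [← hr, Ideal.radical_le_radical_iff, Ideal.span_le]
    rintro _ ⟨j, rfl⟩
    by_cases hj : j = i
    · subst hj
      exact ⟨n, hn⟩
    · exact Ideal.le_radical (Ideal.subset_span ⟨j, hj, rfl⟩)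
  have hmin : maximalIdeal R ∈ (Ideal.span (a '' {i}ᶜ)).minimalPrimes := by
    rw [← Ideal.radical_minimalPrimes, hrad, Ideal.minimalPrimes_eq_subsingleton_self]
    rfl
  have h1 := Ideal.height_le_card_of_mem_minimalPrimes_span (Set.toFinite _) hmin
  have h2 : (a '' {i}ᶜ).ncard ≤ d - 1 := by
    refine (Set.ncard_image_le (Set.toFinite _)).trans ?_
    rw [Set.ncard_compl, Set.ncard_singleton, Nat.card_eq_fintype_card, Fintype.card_fin]
  have h3 : ((maximalIdeal R).height : WithBot ℕ∞) = d :=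
    maximalIdeal_height_eq_ringKrullDim.trans hd
  have h4 : (maximalIdeal R).height = d := by exact_mod_cast h3
  rw [h4] at h1
  have h5 : d ≤ d - 1 := (by exact_mod_cast h1 : d ≤ _).trans h2
  have := i.pos
  omega

lemma mem_span_image_compl_of_mul_mem [IsNoetherianRing R]
    (h : ∀ a b : Ideal R, IsParameterIdeal R a → IsParameterIdeal R b → b ≤ a →
      Submodule.IsPrincipal (⊤ : Submodule R ((R ⧸ a) →ₗ[R] (R ⧸ b))))
    (hd : ringKrullDim R = d) (ha : ∀ i, a i ∈ maximalIdeal R)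
    (hr : (Ideal.span (Set.range a)).radical = maximalIdeal R) (i : Fin d) {z : R}
    (hz : a i * z ∈ Ideal.span (a '' {i}ᶜ)) : z ∈ Ideal.span (a '' {i}ᶜ) := by
  classical
  refine mem_of_forall_mem_sup_pow fun n => ?_
  refine (sup_le_sup_left ((Ideal.span_singleton_le_iff_mem _).mpr
    (Ideal.pow_mem_pow (ha i) n)) _) (?_ : z ∈ Ideal.span (a '' {i}ᶜ) ⊔ Ideal.span {a i ^ n})
  have hB : Ideal.span (Set.range fun j => a j ^ (if j = i then n + 1 else 1)) =
      Ideal.span (a '' {i}ᶜ) ⊔ Ideal.span {a i ^ (n + 1)} := by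
    rw [← Ideal.span_union]
    congr 1
    ext y
    constructor
    · rintro ⟨j, rfl⟩
      by_cases hj : j = i
      · subst hj; right; simp
      · left; exact ⟨j, hj, by simp [hj]⟩
    · rintro (⟨j, hj, rfl⟩ | rfl)
      · exact ⟨j, by simp [show j ≠ i from hj]⟩
      · exact ⟨i, by simp⟩
  have hpb := isParameterIdeal_span_pow hd ha hr
    (e := fun j => if j = i then n + 1 else 1) (by intro j; split_ifs <;> simp)
  have hba : Ideal.span (Set.range fun j => a j ^ (if j = i then n + 1 else 1)) ≤
      Ideal.span (Set.range a) := by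
    rw [Ideal.span_le]
    rintro _ ⟨j, rfl⟩
    exact Ideal.pow_mem_of_mem _ (Ideal.subset_span (Set.mem_range_self j)) _
      (by split_ifs <;> simp)
  obtain ⟨c, hc, hgen⟩ := Ideal.exists_generator_colon_of_isPrincipal_hom
    (h _ _ ⟨d, a, hd, ha, rfl, hr⟩ hpb hba)
  rw [hB] at hc hgen
  have hai : a i ∈ Ideal.span (Set.range a) := Ideal.subset_span (Set.mem_range_self i)
  refine mem_sup_span_pow_of_colon_cyclic (ha i) (pow_notMem_span_image_compl hd hr i _)
    (hc _ hai) (fun y hy => hgen y fun r hr' => ?_) hz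
  have hle : Ideal.span (Set.range a) ≤ Submodule.comap (LinearMap.mulRight R y)
      (Ideal.span (a '' {i}ᶜ) ⊔ Ideal.span {a i ^ (n + 1)}) := by
    refine Submodule.span_le.mpr ?_
    rintro _ ⟨j, rfl⟩
    by_cases hj : j = i
    · subst hj
      exact hy
    · exact Ideal.mul_mem_right _ _
        (Ideal.mem_sup_left (Ideal.subset_span (Set.mem_image_of_mem a hj)))
  exact hle hr'

lemma isRegular_ofFn_of_hom_quotient_cyclic [IsNoetherianRing R]
    (h : ∀ a b : Ideal R, IsParameterIdeal R a → IsParameterIdeal R b → b ≤ a →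
      Submodule.IsPrincipal (⊤ : Submodule R ((R ⧸ a) →ₗ[R] (R ⧸ b))))
    (hd : ringKrullDim R = d) (ha : ∀ i, a i ∈ maximalIdeal R)
    (hr : (Ideal.span (Set.range a)).radical = maximalIdeal R) :
    RingTheory.Sequence.IsRegular R (List.ofFn a) := by
  rw [isRegular_iff_isWeaklyRegular_of_subset_maximalIdeal (by simpa [List.mem_ofFn] using ha)]
  refine ⟨fun i hi => ?_⟩
  have hid : i < d := by simpa using hi
  rw [isSMulRegular_quotient_iff_mem_of_smul_mem]
  intro z hz
  rw [List.getElem_ofFn, smul_eq_mul] at hz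
  rw [smul_eq_mul, Ideal.mul_top] at hz ⊢
  have hmemI : ∀ j : Fin d, (j : ℕ) < i → a j ∈ Ideal.ofList ((List.ofFn a).take i) := by
    intro j hj
    refine Ideal.subset_span (List.mem_take_iff_getElem.mpr ⟨j, by simp [hj], by simp⟩)
  refine mem_of_forall_mem_sup_pow fun n => ?_
  set e : Fin d → ℕ := fun j => if (j : ℕ) ≤ i then 1 else n + 1 with he
  have he0 : ∀ j, e j ≠ 0 := by intro j; rw [he]; dsimp only; split_ifs <;> simp
  have ha' : ∀ j, a j ^ e j ∈ maximalIdeal R :=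
    fun j => Ideal.pow_mem_of_mem _ (ha j) _ (he0 j).bot_lt
  have hrad : (Ideal.span (Set.range fun j => a j ^ e j)).radical = maximalIdeal R := by
    obtain ⟨_, _, _, _, _, H⟩ := isParameterIdeal_span_pow hd ha hr he0
    exact H
  have hmem := mem_span_image_compl_of_mul_mem h hd ha' hrad ⟨i, hid⟩ (z := z) (by
    have : a ⟨i, hid⟩ ^ e ⟨i, hid⟩ = a ⟨i, hid⟩ := by simp [he]
    rw [this]
    refine (Ideal.span_le.mpr ?_ : Ideal.ofList ((List.ofFn a).take i) ≤ _) hz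
    intro y hy
    obtain ⟨j, hj, rfl⟩ := List.mem_take_iff_getElem.mp hy
    have hji : j < i := by simp at hj; omega
    refine Ideal.subset_span ⟨⟨j, hji.trans hid⟩, by simp [hji.ne], by simp [he, hji.le]⟩)
  refine (Ideal.span_le.mpr ?_ : Ideal.span _ ≤ _) hmem
  rintro _ ⟨j, hj, rfl⟩
  rcases lt_trichotomy (j : ℕ) i with hji | hji | hji
  · exact Ideal.mem_sup_left (by simpa [he, hji.le] using hmemI j hji)
  · exact absurd (Fin.ext hji) hj
  · refine Ideal.mem_sup_right ?_
    have : e j = n + 1 := by simp [he, hji]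
    simpa only [this] using Ideal.pow_le_pow_right n.le_succ (Ideal.pow_mem_pow (ha j) (n + 1))

end SystemOfParameters

lemma IsLocalRing.exists_systemOfParameters (R : Type*) [CommRing R] [IsNoetherianRing R]
    [IsLocalRing R] : ∃ (d : ℕ) (a : Fin d → R), ringKrullDim R = d ∧
      (∀ i, a i ∈ maximalIdeal R) ∧ (Ideal.span (Set.range a)).radical = maximalIdeal R := by
  obtain ⟨s, hs, hcard⟩ := (maximalIdeal R).exists_finset_card_eq_height_of_isNoetherianRing
  have hrange : Set.range (fun i => (s.equivFin.symm i : R)) = s := by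
    ext y
    constructor
    · rintro ⟨i, rfl⟩
      exact (s.equivFin.symm i).2
    · exact fun hy => ⟨s.equivFin ⟨y, hy⟩, by simp⟩
  refine ⟨s.card, fun i => s.equivFin.symm i, ?_, fun i => ?_, ?_⟩
  · rw [← maximalIdeal_height_eq_ringKrullDim, ← hcard]
    rfl
  · exact hs.1.2 (Ideal.subset_span (s.equivFin.symm i).2)
  · rw [hrange]
    refine le_antisymm ((maximalIdeal.isMaximal R).isPrime.radical_le_iff.mpr hs.1.2) ?_
    rw [Ideal.radical_eq_sInf]
    refine le_sInf fun J hJ => hs.2 ⟨hJ.2, hJ.1⟩ ?_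
    have := hJ.2
    exact le_maximalIdeal this.ne_top

theorem isCohenMacaulay_of_hom_quotient_cyclic (R : Type*) [CommRing R] [IsNoetherianRing R] [IsLocalRing R]
    (h : ∀ a b : Ideal R, IsParameterIdeal R a → IsParameterIdeal R b → b ≤ a →
      Submodule.IsPrincipal (⊤ : Submodule R ((R ⧸ a) →ₗ[R] (R ⧸ b)))) :
    IsCohenMacaulayLocalRing R := by
  obtain ⟨d, a, hd, ha, hr⟩ := exists_systemOfParameters R
  have hdepth : ringDepth R = d := by
    refine le_antisymm (sSup_le ?_)
      (le_sSup ⟨d, a, rfl, ha, isRegular_ofFn_of_hom_quotient_cyclic h hd ha hr⟩)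
    rintro _ ⟨k, x, rfl, -, hreg⟩
    have hle := ringKrullDim_add_length_eq_ringKrullDim_of_isRegular _ hreg
    have : Nontrivial (R ⧸ Ideal.ofList (List.ofFn x)) := by
      refine Ideal.Quotient.nontrivial_iff.mpr fun htop => hreg.top_ne_smul ?_
      simp [htop]
    rw [hd, List.length_ofFn] at hle
    have hkd : ((k : ℕ) : WithBot ℕ∞) ≤ d := by
      rw [← hle]
      exact le_add_of_nonneg_left ringKrullDim_nonneg_of_nontrivial
    exact_mod_cast hkd
  rw [IsCohenMacaulayLocalRing, hdepth, hd]
  rfl
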